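/- Let n ≥ 1 and let e : ℤ/nℤ → {1, 2} be any function. Then the set of antisymmetries of e has at most two elements. -/

import Mathlib

/-- `c ∈ ℤ/n` encodes the reflection `s_c : i ↦ c - i` of a regular `n`-gon with
vertices `ℤ/n`. Given `e : ℤ/n → {1, 2}`, the reflection `s_c` is an
*antisymmetry* of `e` if it fixes no vertex (its axis passes through midpoints
of two sides, with endpoints `i` satisfying `2i + 1 = c` or `2i - 1 = c`),
`e = 2` on the four endpoints of the two invariant sides, and `e(s_c(i)) ≠ e(i)`
for every other vertex `i`. -/
def IsAntisymmetry {n : ℕ} (e : ZMod n → ℕ) (c : ZMod n) : Prop :=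
  (¬ ∃ i : ZMod n, 2 * i = c) ∧
  (∀ i : ZMod n, (2 * i + 1 = c ∨ 2 * i - 1 = c) → e i = 2) ∧
  (∀ i : ZMod n, ¬ (2 * i + 1 = c ∨ 2 * i - 1 = c) → e (c - i) ≠ e i)

/-- The `±1`-valued function `2e - 3` is anti-invariant under an antisymmetry, up to the
indicator function of the endpoints of the invariant sides. -/
lemma IsAntisymmetry.add_reflect {n : ℕ} {e : ZMod n → ℕ} (he : ∀ i, e i = 1 ∨ e i = 2)
    (h2 : (2 : ZMod n) ≠ 0) {c : ZMod n} (hc : IsAntisymmetry e c) (i : ZMod n) :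
    (2 * (e i : ℂ) - 3) + (2 * (e (c - i) : ℂ) - 3) =
      (if 2 * i = c - 1 then 2 else 0) + (if 2 * i = c + 1 then 2 else 0) := by
  obtain ⟨-, hT, hN⟩ := hc
  by_cases h₁ : 2 * i = c - 1
  · have h₃ : 2 * i ≠ c + 1 := fun h ↦ h2 (by linear_combination h₁ - h)
    rw [if_pos h₁, if_neg h₃, hT i (.inl (by linear_combination h₁)),
      hT (c - i) (.inr (by linear_combination -h₁))]
    norm_num
  by_cases h₃ : 2 * i = c + 1
  · rw [if_neg h₁, if_pos h₃, hT i (.inr (by linear_combination h₃)),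
      hT (c - i) (.inl (by linear_combination -h₃))]
    norm_num
  have hne := hN i (by
    rintro (h | h)
    · exact h₁ (by linear_combination h)
    · exact h₃ (by linear_combination h))
  rw [if_neg h₁, if_neg h₃]
  rcases he i with h | h <;> rcases he (c - i) with h' | h' <;> rw [h, h'] at hne ⊢ <;>
    first | exact absurd rfl hne | norm_num

lemma ZMod.exists_two_mul_add_one {n : ℕ} [NeZero n] {c : ZMod n}
    (hc : ¬ ∃ i : ZMod n, 2 * i = c) : ∃ a : ZMod n, c = 2 * a + 1 := by
  rcases Nat.even_or_odd' c.val with ⟨k, hk | hk⟩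
  · exact absurd ⟨(k : ZMod n), by rw [← ZMod.natCast_zmod_val c, hk]; push_cast; rfl⟩ hc
  · exact ⟨k, by rw [← ZMod.natCast_zmod_val c, hk]; push_cast; rfl⟩

lemma sum_ite_two_mul_eq {n : ℕ} [NeZero n] (ψ : AddChar (ZMod n) ℂ) (a : ZMod n) :
    ∑ i, (if 2 * i = 2 * a then (2 : ℂ) else 0) * ψ (2 * i) =
      (∑ i : ZMod n, if 2 * i = 0 then (2 : ℂ) else 0) * ψ (2 * a) := by
  rw [Finset.sum_mul, ← Equiv.sum_comp (Equiv.addRight a)]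
  refine Finset.sum_congr rfl fun i _ ↦ ?_
  have h : 2 * (i + a) = 2 * a ↔ 2 * i = 0 := by rw [mul_add, add_eq_right]
  simp only [Equiv.coe_addRight, h]
  split_ifs with hi
  · rw [h.2 hi]
  · simp

/-- The value at an antisymmetry of an additive character `ψ` satisfies a quadratic equation,
whose coefficients are Fourier coefficients of `2e - 3`. -/
lemma IsAntisymmetry.quadratic {n : ℕ} [NeZero n] {e : ZMod n → ℕ}
    (he : ∀ i, e i = 1 ∨ e i = 2) (h2 : (2 : ZMod n) ≠ 0) (ψ : AddChar (ZMod n) ℂ)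
    {c : ZMod n} (hc : IsAntisymmetry e c) :
    (∑ i, (2 * (e i : ℂ) - 3) * ψ (2 * i)) +
        ψ c ^ 2 * (∑ i, (2 * (e i : ℂ) - 3) * ψ (-(2 * i))) =
      (∑ i : ZMod n, if 2 * i = 0 then (2 : ℂ) else 0) * (ψ 1 + ψ (-1)) * ψ c := by
  obtain ⟨a, ha⟩ := ZMod.exists_two_mul_add_one hc.1
  have hsum : ∑ i, ((2 * (e i : ℂ) - 3) + (2 * (e (c - i) : ℂ) - 3)) * ψ (2 * i) =
      (∑ i : ZMod n, if 2 * i = 0 then (2 : ℂ) else 0) * (ψ 1 + ψ (-1)) * ψ c := by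
    have h₁ : c - 1 = 2 * a := by linear_combination ha
    have h₃ : c + 1 = 2 * (a + 1) := by linear_combination ha
    simp_rw [hc.add_reflect he h2, add_mul, Finset.sum_add_distrib, h₁, h₃]
    rw [sum_ite_two_mul_eq, sum_ite_two_mul_eq, ← h₁, ← h₃, sub_eq_add_neg,
      AddChar.map_add_eq_mul, AddChar.map_add_eq_mul]
    ring
  rw [← hsum]
  simp_rw [add_mul, Finset.sum_add_distrib, Finset.mul_sum]
  congr 1
  rw [← Equiv.sum_comp (Equiv.subLeft c)]
  refine Finset.sum_congr rfl fun i _ ↦ ?_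
  have h : ψ (2 * i) = ψ c ^ 2 * ψ (-(2 * (c - i))) := by
    rw [pow_two, ← AddChar.map_add_eq_mul, ← AddChar.map_add_eq_mul]
    congr 1
    ring
  rw [h, Equiv.subLeft_apply]
  ring

/-- A quadratic equation with nonzero linear coefficient has at most two roots. -/
lemma eq_or_eq_or_eq_of_quadratic {K : Type*} [Field K] {p q r x y z : K} (hr : r ≠ 0)
    (hx : p + x ^ 2 * q = r * x) (hy : p + y ^ 2 * q = r * y) (hz : p + z ^ 2 * q = r * z) :
    x = y ∨ x = z ∨ y = z := by
  by_contra! ⟨hxy, hxz, hyz⟩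
  have h₁ : (x + y) * q = r :=
    mul_left_cancel₀ (sub_ne_zero.2 hxy) (by linear_combination hx - hy)
  have h₂ : (x + z) * q = r :=
    mul_left_cancel₀ (sub_ne_zero.2 hxz) (by linear_combination hx - hz)
  have hq : q = 0 := (mul_eq_zero.1 (show (y - z) * q = 0 by
    linear_combination h₁ - h₂)).resolve_left (sub_ne_zero.2 hyz)
  exact hr (by rw [← h₁, hq, mul_zero])

/-- **Lemma 9.** For `n ≥ 1` and any `e : ℤ/n → {1, 2}`, there are at most two
antisymmetries of `e`. -/
theorem at_most_two_antisymmetries (n : ℕ) (hn : 1 ≤ n)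
    (e : ZMod n → ℕ) (he : ∀ i, e i = 1 ∨ e i = 2) :
    ∀ c₁ c₂ c₃ : ZMod n, IsAntisymmetry e c₁ → IsAntisymmetry e c₂ →
      IsAntisymmetry e c₃ → c₁ = c₂ ∨ c₁ = c₃ ∨ c₂ = c₃ := by
  intro c₁ c₂ c₃ H₁ H₂ H₃
  have : NeZero n := ⟨by omega⟩
  by_cases h4 : (4 : ZMod n) = 0
  · have hdvd : n ∣ 4 := (ZMod.natCast_eq_zero_iff 4 n).1 (by exact_mod_cast h4)
    have hle := Nat.le_of_dvd (by norm_num) hdvd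
    have h₁ := H₁.1
    have h₂ := H₂.1
    have h₃ := H₃.1
    clear H₁ H₂ H₃ he e this h4
    interval_cases n
    · revert c₁ c₂ c₃; decide
    · revert c₁ c₂ c₃; decide
    · omega
    · revert c₁ c₂ c₃; decide
  have h2 : (2 : ZMod n) ≠ 0 := fun h ↦ h4 (by linear_combination 2 * h)
  have hinj := ZMod.injective_stdAddChar (N := n)
  set ψ : AddChar (ZMod n) ℂ := ZMod.stdAddChar
  have hψ : ψ 1 + ψ (-1) ≠ 0 := by
    intro h
    have hinv : ψ 1 * ψ (-1) = 1 := by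
      rw [← AddChar.map_add_eq_mul, add_neg_cancel, AddChar.map_zero_eq_one]
    have hpow : ψ (4 • (1 : ZMod n)) = ψ 0 := by
      rw [AddChar.map_nsmul_eq_pow, AddChar.map_zero_eq_one]
      linear_combination (ψ 1 ^ 2 - 1) * (ψ 1 * h - hinv)
    exact h4 (by simpa using hinj hpow)
  have hcard : (∑ i : ZMod n, if 2 * i = 0 then (2 : ℂ) else 0) ≠ 0 := by
    rw [← Finset.sum_filter, Finset.sum_const, nsmul_eq_mul]
    refine mul_ne_zero (Nat.cast_ne_zero.2 (Finset.card_ne_zero.2 ⟨0, ?_⟩)) two_ne_zero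
    simp
  have := eq_or_eq_or_eq_of_quadratic (mul_ne_zero hcard hψ)
    (H₁.quadratic he h2 ψ) (H₂.quadratic he h2 ψ) (H₃.quadratic he h2 ψ)
  simpa only [hinj.eq_iff] using this
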